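/- Let m ≥ 4, let G = Sp_{2m}(𝔽₂) be the symplectic group of degree 2m over the field with two elements, and let H be the stabilizer in G of a nonzero vector of 𝔽₂^{2m} (a maximal parabolic subgroup of type P₁). Then there exist irreducible complex characters α, β of H that are not linked over G: no irreducible complex character χ of G satisfies both ⟨χ|_H, α⟩ ≠ 0 and ⟨χ|_H, β⟩ ≠ 0 (equivalently ⟨α^G, β^G⟩ = 0, so d_G(H) ≥ 5). -/

import Mathlib

noncomputable section

/-- The usual inner product of class functions on a finite group `H`. -/
def charInner (H : Type) (φ ψ : H → ℂ) : ℂ :=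
  (Nat.card H : ℂ)⁻¹ * ∑ᶠ h : H, φ h * (starRingEnd ℂ) (ψ h)

/-- `χ : H → ℂ` is the character of an irreducible complex representation of `H`. -/
def IsIrrChar (H : Type) [Group H] (χ : H → ℂ) : Prop :=
  ∃ V : FDRep ℂ H, CategoryTheory.Simple V ∧ χ = V.character

/-- Restriction of a class function on `G` to a subgroup `H`. -/
def resChar {G : Type} [Group G] (H : Subgroup G) (χ : G → ℂ) : ↥H → ℂ :=
  fun h => χ (h : G)

/-- Two irreducible characters `α, β` of a subgroup `H ≤ G` are linked over `G` if some
irreducible character `χ` of `G` satisfies `⟨χ|_H, α⟩ ≠ 0` and `⟨χ|_H, β⟩ ≠ 0`. -/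
def Linked {G : Type} [Group G] (H : Subgroup G) (α β : ↥H → ℂ) : Prop :=
  ∃ χ : G → ℂ, IsIrrChar G χ ∧
    charInner ↥H (resChar H χ) α ≠ 0 ∧ charInner ↥H (resChar H χ) β ≠ 0

/-- `α` and `β` are joined by a path of length at most `m` in the Külshammer graph
`K(G,H)`: there is a chain of irreducible characters of `H`, of length `k ≤ m`, from `α`
to `β` in which consecutive members are linked over `G`. -/
def LinkedPathLE {G : Type} [Group G] (H : Subgroup G) (m : ℕ) (α β : ↥H → ℂ) : Prop :=
  ∃ k ≤ m, ∃ f : ℕ → (↥H → ℂ), f 0 = α ∧ f k = β ∧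
    (∀ i ≤ k, IsIrrChar ↥H (f i)) ∧ ∀ i < k, Linked H (f i) (f (i + 1))

/-- The conjugate subgroup `g H g⁻¹`. -/
def conjSub {G : Type} [Group G] (g : G) (H : Subgroup G) : Subgroup G :=
  H.map (MulAut.conj g).toMonoidHom

/-! ### Characters of finite groups -/

open CategoryTheory in
/-- A nonzero invariant subspace of a simple object of `FDRep k G` is the whole space. -/
theorem FDRep.eq_top_of_simple {k G : Type} [Field k] [Group G] (V : FDRep k G) [Simple V]
    (p : Submodule k V) (hp : ∀ g, ∀ x ∈ p, V.ρ g x ∈ p) (hne : p ≠ ⊥) : p = ⊤ := by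
  let σ : Representation k G p :=
    { toFun := fun g => (V.ρ g).restrict (hp g)
      map_one' := by ext; simp
      map_mul' := fun g h => by ext; simp }
  let ι : FDRep.of σ ⟶ V :=
    ⟨InducedCategory.homMk (ModuleCat.ofHom p.subtype), fun g => by
      ext x
      rfl⟩
  have hι : ∀ x : p, ι.hom.hom.hom x = (x : V) := fun _ => rfl
  have : Mono ι := by
    refine ⟨fun f g hfg => ?_⟩
    ext x
    exact LinearMap.congr_fun (congrArg (fun φ => φ.hom.hom.hom) hfg) x
  have h0 : ι ≠ 0 := by
    intro h
    apply hne
    rw [Submodule.eq_bot_iff]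
    intro x hx
    have := hι ⟨x, hx⟩
    rw [h] at this
    exact this.symm
  have : IsIso ι := isIso_of_mono_of_nonzero h0
  rw [eq_top_iff]
  intro x _
  have h1 : ι.hom.hom.hom ((inv ι).hom.hom.hom x) = x :=
    LinearMap.congr_fun (congrArg (fun φ => φ.hom.hom.hom) (IsIso.inv_hom_id ι)) x
  rw [← h1]
  exact ((inv ι).hom.hom.hom x : p).2

open Matrix ComplexOrder in
/-- For a complex matrix representation of a finite group, the trace at `g⁻¹` is the complex
conjugate of the trace at `g`. -/
theorem Matrix.trace_map_inv_eq_conj {G n : Type*} [Group G] [Finite G] [Fintype n]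
    [DecidableEq n] (ρ : G →* Matrix n n ℂ) (g : G) :
    (ρ g⁻¹).trace = (starRingEnd ℂ) (ρ g).trace := by
  classical
  have := Fintype.ofFinite G
  let P : Matrix n n ℂ := ∑ h, (ρ h)ᴴ * ρ h
  have hP : P.PosDef := by
    have : P = 1 + ∑ h ∈ Finset.univ.erase 1, (ρ h)ᴴ * ρ h := by
      simp only [P]
      rw [← Finset.add_sum_erase _ _ (Finset.mem_univ (1 : G))]
      simp
    rw [this]
    exact PosDef.one.add_posSemidef
      (posSemidef_sum _ fun h _ => posSemidef_conjTranspose_mul_self _)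
  have hinv : (ρ g)ᴴ * P = P * ρ g⁻¹ := by
    have h1 : (ρ g)ᴴ * P * ρ g = P := by
      simp only [P, Finset.mul_sum, Finset.sum_mul]
      rw [← Equiv.sum_comp (Equiv.mulRight g) fun h => (ρ h)ᴴ * ρ h]
      simp [Matrix.mul_assoc]
    conv_rhs => rw [← h1]
    rw [Matrix.mul_assoc, ← map_mul]
    simp
  have hdet : IsUnit P.det := (Matrix.isUnit_iff_isUnit_det _).1 hP.isUnit
  have : ρ g⁻¹ = P⁻¹ * ((ρ g)ᴴ * P) := by
    rw [hinv, ← Matrix.mul_assoc, Matrix.nonsing_inv_mul _ hdet, Matrix.one_mul]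
  rw [this, Matrix.trace_mul_comm, Matrix.mul_assoc, Matrix.mul_nonsing_inv _ hdet,
    Matrix.mul_one, Matrix.trace_conjTranspose]
  rfl

theorem Representation.character_inv_eq_conj {G V : Type*} [Group G] [Finite G] [AddCommGroup V]
    [Module ℂ V] [FiniteDimensional ℂ V] (ρ : Representation ℂ G V) (g : G) :
    ρ.character g⁻¹ = (starRingEnd ℂ) (ρ.character g) := by
  let b := Module.finBasis ℂ V
  have h := Matrix.trace_map_inv_eq_conj
    ((LinearMap.toMatrixAlgEquiv b).toAlgHom.toRingHom.toMonoidHom.comp ρ) g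
  simp only [Representation.character, LinearMap.trace_eq_matrix_trace ℂ b]
  exact h

/-- The character of an irreducible representation is an irreducible character. -/
theorem Representation.isIrrChar_character {G W : Type} [Group G] [Finite G] [AddCommGroup W]
    [Module ℂ W] [FiniteDimensional ℂ W] (ρ : Representation ℂ G W) [ρ.IsIrreducible] :
    IsIrrChar G ρ.character := by
  have := Fintype.ofFinite G
  have h0 : (Nat.card G : ℂ) ≠ 0 := by exact_mod_cast Nat.card_pos.ne'
  have := invertibleOfNonzero h0
  refine ⟨FDRep.of ρ, ?_, rfl⟩
  rw [FDRep.simple_iff_char_is_norm_one]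
  have h := Representation.char_orthonormal ρ ρ
  rw [if_pos ⟨Representation.Equiv.refl ρ⟩, inv_mul_eq_one₀ h0] at h
  exact h.symm

/-- A nonzero scalar product with the character of `ρ` gives a nonzero intertwining map
from `ρ`. -/
theorem Representation.exists_intertwiningMap_ne_zero {G V W : Type} [Group G] [Finite G]
    [AddCommGroup V] [Module ℂ V] [FiniteDimensional ℂ V] [AddCommGroup W] [Module ℂ W]
    [FiniteDimensional ℂ W] (ρ : Representation ℂ G V) (σ : Representation ℂ G W)
    (h : charInner G σ.character ρ.character ≠ 0) :
    ∃ f : Representation.IntertwiningMap ρ σ, f ≠ 0 := by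
  have := Fintype.ofFinite G
  have h0 : (Nat.card G : ℂ) ≠ 0 := by exact_mod_cast Nat.card_pos.ne'
  have := invertibleOfNonzero h0
  by_contra! hf
  have : Subsingleton (Representation.IntertwiningMap ρ σ) :=
    ⟨fun f g => (hf f).trans (hf g).symm⟩
  apply h
  rw [charInner, finsum_eq_sum_of_fintype]
  simp_rw [← Representation.character_inv_eq_conj]
  rw [Representation.card_inv_mul_sum_char_mul_char_eq_finrank,
    Module.finrank_zero_of_subsingleton, Nat.cast_zero]

open scoped MonoidAlgebra in
theorem Representation.asAlgebraHom_ofModule' {k G M : Type*} [Field k] [Group G] [AddCommGroup M]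
    [Module k M] [Module k[G] M] [IsScalarTower k k[G] M] (r : k[G]) (x : M) :
    (Representation.ofModule' (k := k) (G := G) M).asAlgebraHom r x = r • x := by
  simp [Representation.ofModule', Representation.asAlgebraHom]

open scoped MonoidAlgebra in
theorem Representation.isIrreducible_ofModule' {k G M : Type*} [Field k] [Group G]
    [AddCommGroup M] [Module k M] [Module k[G] M] [IsScalarTower k k[G] M]
    [IsSimpleModule k[G] M] : (Representation.ofModule' (k := k) (G := G) M).IsIrreducible := by
  rw [Representation.irreducible_iff_isSimpleModule_asModule]
  let ρ := Representation.ofModule' (k := k) (G := G) M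
  exact IsSimpleModule.congr (N := M)
    { toAddEquiv := ρ.asModuleEquiv.toAddEquiv
      map_smul' := fun r x => by
        simpa [ρ] using Representation.asAlgebraHom_ofModule' r (ρ.asModuleEquiv x) }

open scoped MonoidAlgebra in
/-- A nonzero element of the complex group algebra acts nontrivially on some irreducible
representation. -/
theorem exists_isIrreducible_asAlgebraHom_ne_zero {G : Type} [Group G] [Finite G]
    {e : ℂ[G]} (he : e ≠ 0) :
    ∃ (W : Type) (_ : AddCommGroup W) (_ : Module ℂ W) (_ : FiniteDimensional ℂ W)
      (ρ : Representation ℂ G W), ρ.IsIrreducible ∧ ρ.asAlgebraHom e ≠ 0 := by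
  have : NeZero (Nat.card G : ℂ) := ⟨by exact_mod_cast Nat.card_pos.ne'⟩
  have hj : Ring.jacobson ℂ[G] = ⊥ := IsSemisimpleModule.jacobson_eq_bot ℂ[G] ℂ[G]
  obtain ⟨I, hI, heI⟩ : ∃ I : Ideal ℂ[G], I.IsMaximal ∧ e ∉ I := by
    by_contra! h
    apply he
    rw [← Ideal.mem_bot, ← hj, Ring.jacobson_eq_sInf_isMaximal, Submodule.mem_sInf]
    exact h
  have hM : IsSimpleModule ℂ[G] (ℂ[G] ⧸ I) := isSimpleModule_iff_isCoatom.2 hI.out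
  refine ⟨ℂ[G] ⧸ I, inferInstance, inferInstance, Module.Finite.trans ℂ[G] _,
    Representation.ofModule' (ℂ[G] ⧸ I), Representation.isIrreducible_ofModule', fun h => heI ?_⟩
  have h1 := LinearMap.congr_fun h (Submodule.Quotient.mk 1)
  rw [Representation.asAlgebraHom_ofModule', LinearMap.zero_apply, ← Submodule.Quotient.mk_smul,
    Submodule.Quotient.mk_eq_zero] at h1
  simpa using h1

theorem isIrrChar_one {G : Type} [Group G] [Finite G] : IsIrrChar G 1 := by
  have := Fintype.ofFinite G
  have h : (FDRep.of (Representation.trivial ℂ G ℂ)).character = 1 := by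
    ext g
    simp [FDRep.character]
  refine ⟨FDRep.of (Representation.trivial ℂ G ℂ), ?_, h.symm⟩
  rw [FDRep.simple_iff_char_is_norm_one, h]
  simp

/-- Let `a, b, c` be commuting elements of `H` such that every conjugate of `H` in `G` contains
one of them, and none of `a`, `b`, `c`, `abc` is trivial. Then some irreducible character of `H`
is not linked to the trivial character: `(1 - a)(1 - b)(1 - c)` is a nonzero element of `ℂ[H]`
annihilating every representation of `G` generated by an `H`-fixed vector. -/
theorem exists_not_linked_one {G : Type} [Group G] [Finite G] (H : Subgroup G) (a b c : H)
    (hab : Commute a b) (hac : Commute a c) (hbc : Commute b c)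
    (ha : a ≠ 1) (hb : b ≠ 1) (hc : c ≠ 1) (habc : a * b * c ≠ 1)
    (hconj : ∀ g : G, g⁻¹ * a * g ∈ H ∨ g⁻¹ * b * g ∈ H ∨ g⁻¹ * c * g ∈ H) :
    ∃ α : H → ℂ, IsIrrChar H α ∧ ¬ Linked H α 1 := by
  classical
  let s : H → MonoidAlgebra ℂ H := MonoidAlgebra.of ℂ H
  have he : (1 - s a) * (1 - s b) * (1 - s c) ≠ 0 := by
    intro h
    have h1 : (1 - s a) * (1 - s b) * (1 - s c) =
        s 1 + s (a * b) + s (a * c) + s (b * c) - s a - s b - s c - s (a * b * c) := by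
      simp only [s, map_mul, map_one]
      noncomm_ring
    rw [h1] at h
    have h2 := congrArg (fun f : MonoidAlgebra ℂ H => f.coeff 1) h
    simp [s, Finsupp.single_apply, ha, hb, hc, habc] at h2
    split_ifs at h2 <;> norm_num at h2
  obtain ⟨W, _, _, _, ρ, hρ, hne⟩ := exists_isIrreducible_asAlgebraHom_ne_zero he
  refine ⟨ρ.character, ρ.isIrrChar_character, ?_⟩
  rintro ⟨_, ⟨V, hV, rfl⟩, h1, h2⟩
  let σ : Representation ℂ H V := (V.ρ).comp H.subtype
  obtain ⟨f, hf⟩ := Representation.exists_intertwiningMap_ne_zero ρ σ h1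
  have hinj : Function.Injective f :=
    (Representation.IsIrreducible.injective_or_eq_zero f).resolve_right hf
  have htriv : (Representation.trivial ℂ H ℂ).character = 1 := by
    ext g
    simp [Representation.character]
  obtain ⟨t, ht⟩ := Representation.exists_intertwiningMap_ne_zero
    (Representation.trivial ℂ H ℂ) σ (by rw [htriv]; exact h2)
  obtain ⟨w, hw, hfix⟩ : ∃ w : V, w ≠ 0 ∧ ∀ h ∈ H, V.ρ h w = w := by
    refine ⟨t 1, fun h0 => ht ?_, fun h hh => ?_⟩
    · ext
      exact h0
    · exact (LinearMap.congr_fun (t.isIntertwining' ⟨h, hh⟩) 1).symm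
  have hspan : Submodule.span ℂ (Set.range fun g => V.ρ g w) = ⊤ := by
    refine FDRep.eq_top_of_simple V _ (fun g x hx => ?_) fun h => hw ?_
    · rw [← Submodule.mem_comap]
      refine (Submodule.span_le.2 ?_) hx
      rintro _ ⟨k, rfl⟩
      exact Submodule.subset_span ⟨g * k, by simp⟩
    · rw [Submodule.span_eq_bot] at h
      exact h w ⟨1, by simp⟩
  have hfixed : ∀ (g : G) (h : H), g⁻¹ * h * g ∈ H → V.ρ h (V.ρ g w) = V.ρ g w := by
    intro g h hg
    have := congrArg (V.ρ g) (hfix _ hg)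
    simpa [← Module.End.mul_apply, ← map_mul, mul_assoc] using this
  have hzero : (1 - σ a) * (1 - σ b) * (1 - σ c) = 0 := by
    refine LinearMap.ext_on_range hspan fun g => ?_
    have hcomm : ∀ x y : H, Commute x y → Commute (1 - σ x) (1 - σ y) := fun x y h =>
      ((Commute.one_left _).sub_left ((Commute.one_right _).sub_right (h.map σ)))
    have hkill : ∀ x : H, g⁻¹ * x * g ∈ H → (1 - σ x) (V.ρ g w) = 0 := fun x hx =>
      sub_eq_zero.2 (hfixed g x hx).symm
    rcases hconj g with h | h | h
    · rw [(hcomm a b hab).eq, mul_assoc, (hcomm a c hac).eq, ← mul_assoc, Module.End.mul_apply,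
        hkill a h, map_zero, LinearMap.zero_apply]
    · rw [mul_assoc, (hcomm b c hbc).eq, ← mul_assoc, Module.End.mul_apply,
        hkill b h, map_zero, LinearMap.zero_apply]
    · rw [Module.End.mul_apply, hkill c h, map_zero, LinearMap.zero_apply]
  apply hne
  have hsub : ∀ (x : H) (y : W), f ((1 - ρ x) y) = (1 - σ x) (f y) := fun x y => by
    simp [f.isIntertwining]
  ext y
  apply hinj
  simp only [s, map_mul, map_sub, map_one, Representation.asAlgebraHom_of, Module.End.mul_apply,
    LinearMap.zero_apply, map_zero, hsub]
  exact LinearMap.congr_fun hzero (f y)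

/-! ### Symplectic transvections -/

namespace Matrix

variable {l R : Type*} [Fintype l] [DecidableEq l] [CommRing R]

/-- The symplectic transvection `x ↦ x + ω(u, x) u`. -/
def sympTransvection (u : l ⊕ l → R) : Matrix (l ⊕ l) (l ⊕ l) R :=
  1 + vecMulVec u (J l R *ᵥ u)

theorem J_mulVec_dotProduct_comm (u w : l ⊕ l → R) : J l R *ᵥ u ⬝ᵥ w = -(J l R *ᵥ w ⬝ᵥ u) := by
  rw [dotProduct_comm, dotProduct_mulVec, ← mulVec_transpose, J_transpose, neg_mulVec,
    neg_dotProduct]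

theorem J_mulVec_dotProduct_self (u : l ⊕ l → R) : J l R *ᵥ u ⬝ᵥ u = 0 := by
  simp [J, dotProduct, fromBlocks_mulVec, neg_mulVec, mul_comm]

theorem sympTransvection_mulVec (u x : l ⊕ l → R) :
    sympTransvection u *ᵥ x = x + (J l R *ᵥ u ⬝ᵥ x) • u := by
  ext i
  simp [sympTransvection, add_mulVec, vecMulVec_mulVec, mul_comm]

theorem sympTransvection_mem (u : l ⊕ l → R) : sympTransvection u ∈ symplecticGroup l R := by
  have h1 : (J l R *ᵥ u) ᵥ* J l R = u := by
    rw [← mulVec_transpose, mulVec_mulVec, J_transpose, neg_mul, J_squared, neg_neg, one_mulVec]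
  rw [SymplecticGroup.mem_iff, sympTransvection, transpose_add, transpose_one,
    transpose_vecMulVec, add_mul, add_mul, one_mul, vecMulVec_mul, h1, mul_add, mul_add, mul_one,
    mul_one, mul_vecMulVec, mulVec_mulVec, J_squared, vecMulVec_mul_vecMulVec]
  rw [dotProduct_comm, J_mulVec_dotProduct_self, zero_smul, vecMulVec_zero, add_zero, neg_mulVec,
    one_mulVec, neg_vecMulVec]
  abel

theorem sympTransvection_mulVec_eq_self {u x : l ⊕ l → R} (h : J l R *ᵥ u ⬝ᵥ x = 0) :
    sympTransvection u *ᵥ x = x := by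
  rw [sympTransvection_mulVec, h, zero_smul, add_zero]

theorem sympTransvection_mul {u w : l ⊕ l → R} (h : J l R *ᵥ u ⬝ᵥ w = 0) :
    sympTransvection u * sympTransvection w =
      1 + vecMulVec u (J l R *ᵥ u) + vecMulVec w (J l R *ᵥ w) := by
  rw [sympTransvection, sympTransvection, add_mul, mul_add, mul_add, vecMulVec_mul_vecMulVec, h]
  simp
  abel

theorem commute_sympTransvection {u w : l ⊕ l → R} (h : J l R *ᵥ u ⬝ᵥ w = 0) :
    Commute (sympTransvection u) (sympTransvection w) := by
  have h' : J l R *ᵥ w ⬝ᵥ u = 0 := by rw [J_mulVec_dotProduct_comm, h, neg_zero]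
  rw [Commute, SemiconjBy, sympTransvection_mul h, sympTransvection_mul h', add_right_comm]

/-- The form defined by `J` is nondegenerate. -/
theorem exists_J_mulVec_dotProduct_ne_zero {u : l ⊕ l → R} (hu : u ≠ 0) :
    ∃ x, J l R *ᵥ u ⬝ᵥ x ≠ 0 := by
  by_contra! h
  apply hu
  have h1 : J l R *ᵥ u = 0 := dotProduct_eq_zero _ h
  have h2 : J l R *ᵥ (J l R *ᵥ u) = -u := by
    rw [mulVec_mulVec, J_squared, neg_mulVec, one_mulVec]
  rw [h1, mulVec_zero] at h2
  exact neg_eq_zero.1 h2.symm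

theorem sympTransvection_ne_one [IsDomain R] {u : l ⊕ l → R} (hu : u ≠ 0) :
    sympTransvection u ≠ 1 := by
  obtain ⟨x, hx⟩ := exists_J_mulVec_dotProduct_ne_zero hu
  intro h
  have h1 := sympTransvection_mulVec u x
  rw [h, one_mulVec, left_eq_add] at h1
  exact (smul_ne_zero hx hu) h1

theorem sympTransvection_mul_mul_ne_one {u w : l ⊕ l → ZMod 2} (h : J l (ZMod 2) *ᵥ u ⬝ᵥ w = 0)
    (hu : u ≠ 0) (hw : w ≠ 0) (huw : u ≠ w) :
    sympTransvection u * sympTransvection w * sympTransvection (u + w) ≠ 1 := by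
  obtain ⟨x, hx⟩ := exists_J_mulVec_dotProduct_ne_zero hw
  have h' : J l (ZMod 2) *ᵥ w ⬝ᵥ u = 0 := by rw [J_mulVec_dotProduct_comm, h, neg_zero]
  intro h1
  have h2 := congrArg (· *ᵥ x) h1
  have hbit : ∀ r : ZMod 2, r = 0 ∨ r = 1 := by decide
  simp only [← mulVec_mulVec, sympTransvection_mulVec, one_mulVec, dotProduct_add, mulVec_add,
    add_dotProduct, h, h', J_mulVec_dotProduct_self, dotProduct_smul, smul_zero, add_zero, zero_smul,
    (hbit _).resolve_left hx] at h2
  rcases hbit (J l (ZMod 2) *ᵥ u ⬝ᵥ x) with hr | hr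
  · refine hu (funext fun i => ?_)
    have key : ∀ y p q : ZMod 2, y + q + (p + q) = y → p = 0 := by decide
    exact key (x i) (u i) (w i) (by simpa [hr] using congrFun h2 i)
  · refine huw (funext fun i => ?_)
    have key : ∀ y p q : ZMod 2, y + p + q + ((1 + 1) * p + (1 + 1) * q) = y → p = q := by decide
    exact key (x i) (u i) (w i) (by simpa [hr] using congrFun h2 i)

end Matrix

open Matrix in
/-- Let `m ≥ 4`, let `G = Sp_{2m}(𝔽₂)` be the symplectic group (matrices
preserving the standard nondegenerate alternating form `J`), and let `H` be the stabilizer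
in `G` of a nonzero vector `v` of `𝔽₂^{2m}`. Then some two irreducible complex characters
of `H` are not linked over `G` (equivalently `⟨α^G, β^G⟩ = 0`, so `d_G(H) ≥ 5`). -/
theorem parabolic_Sp2m2_not_linked (m : ℕ) (hm : 4 ≤ m)
    (v : (Fin m ⊕ Fin m) → ZMod 2) (hv : v ≠ 0)
    (H : Subgroup ↥(Matrix.symplecticGroup (Fin m) (ZMod 2)))
    (hH : ∀ g : ↥(Matrix.symplecticGroup (Fin m) (ZMod 2)),
      g ∈ H ↔ Matrix.mulVec (g : Matrix (Fin m ⊕ Fin m) (Fin m ⊕ Fin m) (ZMod 2)) v = v) :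
    ∃ α β : ↥H → ℂ, IsIrrChar ↥H α ∧ IsIrrChar ↥H β ∧ ¬ Linked H α β := by
  have : Finite ↥(symplecticGroup (Fin m) (ZMod 2)) := Subtype.finite
  obtain ⟨w, hvw, hw⟩ : ∃ w, J (Fin m) (ZMod 2) *ᵥ v ⬝ᵥ w = 0 ∧
      w ∉ Submodule.span (ZMod 2) {v} := by
    let φ := dotProductBilin (ZMod 2) (ZMod 2) (J (Fin m) (ZMod 2) *ᵥ v)
    by_contra! h
    have h1 : LinearMap.ker φ ≤ Submodule.span (ZMod 2) {v} := fun w hw => h w hw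
    have h2 := Submodule.finrank_mono h1
    have h3 := φ.finrank_range_add_finrank_ker
    have h4 := (LinearMap.range φ).finrank_le
    rw [finrank_span_singleton hv] at h2
    simp at h3 h4
    omega
  have hw0 : w ≠ 0 := fun h => hw (h ▸ Submodule.zero_mem _)
  have hne : v ≠ w := fun h => hw (h ▸ Submodule.mem_span_singleton_self v)
  have hc0 : v + w ≠ 0 := fun h => hne <| funext fun i => CharTwo.add_eq_zero.1 (congrFun h i)
  let T : (u : (Fin m ⊕ Fin m) → ZMod 2) → symplecticGroup (Fin m) (ZMod 2) := fun u =>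
    ⟨sympTransvection u, sympTransvection_mem u⟩
  have hvv := J_mulVec_dotProduct_self v
  have hww := J_mulVec_dotProduct_self w
  have hwv : J (Fin m) (ZMod 2) *ᵥ w ⬝ᵥ v = 0 := by
    rw [J_mulVec_dotProduct_comm, hvw, neg_zero]
  have hmem : ∀ u, J (Fin m) (ZMod 2) *ᵥ u ⬝ᵥ v = 0 → T u ∈ H := fun u hu =>
    (hH _).2 (sympTransvection_mulVec_eq_self hu)
  have hconj : ∀ (g : symplecticGroup (Fin m) (ZMod 2)) u,
      J (Fin m) (ZMod 2) *ᵥ u ⬝ᵥ (g.1 *ᵥ v) = 0 → g⁻¹ * T u * g ∈ H := fun g u hu => by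
    have hg : (g⁻¹).1 * g.1 = 1 := congrArg Subtype.val (inv_mul_cancel g)
    rw [hH]
    change ((g⁻¹).1 * sympTransvection u * g.1) *ᵥ v = v
    rw [← mulVec_mulVec, ← mulVec_mulVec, sympTransvection_mulVec_eq_self hu, mulVec_mulVec, hg,
      one_mulVec]
  have hcomm : ∀ (x y) (hx : T x ∈ H) (hy : T y ∈ H), J (Fin m) (ZMod 2) *ᵥ x ⬝ᵥ y = 0 →
      Commute (⟨T x, hx⟩ : H) ⟨T y, hy⟩ := fun x y hx hy hxy =>
    Subtype.ext (Subtype.ext (commute_sympTransvection hxy))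
  have hne1 : ∀ (x) (hx : T x ∈ H), x ≠ 0 → (⟨T x, hx⟩ : H) ≠ 1 := fun x hx hx0 h =>
    sympTransvection_ne_one hx0 (congrArg (fun y : H => y.1.1) h)
  obtain ⟨α, hα, hlink⟩ := exists_not_linked_one H ⟨T v, hmem v hvv⟩ ⟨T w, hmem w hwv⟩
    ⟨T (v + w), hmem _ (by rw [mulVec_add, add_dotProduct, hvv, hwv, add_zero])⟩
    (hcomm _ _ _ _ hvw) (hcomm _ _ _ _ (by rw [dotProduct_add, hvv, hvw, add_zero]))
    (hcomm _ _ _ _ (by rw [dotProduct_add, hwv, hww, add_zero]))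
    (hne1 _ _ hv) (hne1 _ _ hw0) (hne1 _ _ hc0)
    (fun h => sympTransvection_mul_mul_ne_one hvw hv hw0 hne
      (congrArg (fun y : H => y.1.1) h))
    (fun g => by
      have hbit : ∀ r s : ZMod 2, r = 0 ∨ s = 0 ∨ r + s = 0 := by decide
      refine (hbit (J (Fin m) (ZMod 2) *ᵥ v ⬝ᵥ (g.1 *ᵥ v))
        (J (Fin m) (ZMod 2) *ᵥ w ⬝ᵥ (g.1 *ᵥ v))).imp (hconj g v) (Or.imp (hconj g w) fun h => ?_)
      exact hconj g (v + w) (by rw [mulVec_add, add_dotProduct, h]))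
  exact ⟨α, 1, hα, isIrrChar_one, hlink⟩
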